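/- arXiv:1409.6069 — 5 statements merged into one kernel-verified Lean document; each statement's English description precedes it below -/
import Mathlib

section
/- Let a, b > 0 be real numbers and let c : [0,1] → ℝ be a continuous function such that b² − 4·a·c(t) > 0 for all t ∈ [0,1]. Suppose x : [0,1] → ℝ is a continuous function satisfying a·x(t)² − b·x(t) + c(t) ≥ 0 for all t ∈ [0,1]. If c(0) = 0 and x(0) = 0, then x(1) ≤ (b − √(b² − 4·a·c(1)))/(2a). -/
open Matrix

noncomputable def frobNorm {k : ℕ} (A : Matrix (Fin k) (Fin k) ℝ) : ℝ :=
  Real.sqrt (∑ i, ∑ j, (A i j) ^ 2)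

noncomputable def specNorm {k : ℕ} (A : Matrix (Fin k) (Fin k) ℝ) : ℝ :=
  ‖Matrix.toEuclideanCLM (𝕜 := ℝ) A‖

noncomputable def kappa2 {k : ℕ} (A : Matrix (Fin k) (Fin k) ℝ) : ℝ :=
  specNorm A⁻¹ * specNorm A

noncomputable def upTri {k : ℕ} (A : Matrix (Fin k) (Fin k) ℝ) : Matrix (Fin k) (Fin k) ℝ :=
  Matrix.of fun i j => if i < j then A i j else if i = j then A i i / 2 else 0

noncomputable def Jmat (m n : ℕ) : Matrix (Fin (m + n)) (Fin (m + n)) ℝ :=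
  Matrix.diagonal fun i => if (i : ℕ) < m then 1 else -1

def IsLowerTri {k : ℕ} (A : Matrix (Fin k) (Fin k) ℝ) : Prop :=
  ∀ i j, i < j → A i j = 0

def IsUpperTri {k : ℕ} (A : Matrix (Fin k) (Fin k) ℝ) : Prop :=
  ∀ i j, j < i → A i j = 0

def PosDiag {k : ℕ} (A : Matrix (Fin k) (Fin k) ℝ) : Prop :=
  ∀ i, 0 < A i i

noncomputable def entAbs {k : ℕ} (A : Matrix (Fin k) (Fin k) ℝ) : Matrix (Fin k) (Fin k) ℝ :=
  Matrix.of fun i j => |A i j|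

noncomputable def condF {k : ℕ} (A : Matrix (Fin k) (Fin k) ℝ) : ℝ :=
  frobNorm (entAbs A⁻¹ * entAbs A)

theorem stmt0 (a b : ℝ) (c x : ℝ → ℝ) (ha : 0 < a) (hb : 0 < b)
    (hc : ContinuousOn c (Set.Icc 0 1)) (hx : ContinuousOn x (Set.Icc 0 1))
    (hdisc : ∀ t ∈ Set.Icc (0:ℝ) 1, b ^ 2 - 4 * a * c t > 0)
    (hineq : ∀ t ∈ Set.Icc (0:ℝ) 1, a * x t ^ 2 - b * x t + c t ≥ 0)
    (hc0 : c 0 = 0) (hx0 : x 0 = 0) :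
    x 1 ≤ (b - Real.sqrt (b ^ 2 - 4 * a * c 1)) / (2 * a) := by
  have h1 : (1:ℝ) ∈ Set.Icc (0:ℝ) 1 := by simp
  have hlt : x 1 < b / (2 * a) := by
    by_contra! h
    have h0 : x 0 ≤ b / (2 * a) := by
      rw [hx0]
      positivity
    obtain ⟨t, ht, hxt⟩ := intermediate_value_Icc zero_le_one hx ⟨h0, h⟩
    have hvertex : 2 * a * x t = b := by
      rw [hxt]
      field_simp
    nlinarith [hdisc t ht, mul_nonneg ha.le (hineq t ht)]
  rw [lt_div_iff₀ (by positivity)] at hlt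
  rw [le_div_iff₀ (by positivity)]
  have hsqrt : Real.sqrt (b ^ 2 - 4 * a * c 1) ≤ b - x 1 * (2 * a) :=
    Real.sqrt_le_iff.mpr ⟨by linarith, by nlinarith [mul_nonneg ha.le (hineq 1 h1)]⟩
  linarith
end

section
/- Let A be an m×m symmetric positive definite real matrix, B an n×m real matrix of rank n, and C an n×n symmetric positive semidefinite real matrix, and let K be the (m+n)×(m+n) block matrix K = [[A, Bᵀ], [B, −C]]. Then there exists an (m+n)×(m+n) lower triangular real matrix L with positive diagonal entries such that K = L · J_{m+n} · Lᵀ. -/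
open Matrix

theorem Matrix.vecMul_injective_of_rank_eq {m n K : Type*} [Fintype m] [Fintype n] [Field K]
    {B : Matrix n m K} (hB : B.rank = Fintype.card n) : Function.Injective B.vecMul := by
  rw [Matrix.vecMul_injective_iff, linearIndependent_iff_card_eq_finrank_span, ← hB,
    Matrix.rank_eq_finrank_span_row, Set.finrank]

theorem LDL.lower_lowerTri {k : ℕ} {S : Matrix (Fin k) (Fin k) ℝ} (hS : S.PosDef) :
    IsLowerTri (LDL.lower hS) := by
  have h : (LDL.lowerInv hS).BlockTriangular OrderDual.toDual := fun i j hij =>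
    LDL.lowerInv_triangular hS hij
  exact fun i j hij => blockTriangular_inv_of_blockTriangular h hij

theorem IsLowerTri.diag_ne_zero {k : ℕ} {L : Matrix (Fin k) (Fin k) ℝ} (hL : IsLowerTri L)
    (hdet : L.det ≠ 0) (i : Fin k) : L i i ≠ 0 := by
  rw [Matrix.det_of_isLowerTriangular L fun i j hij => hL i j hij] at hdet
  exact Finset.prod_ne_zero_iff.mp hdet i (Finset.mem_univ i)

theorem LDL.diagEntries_pos {k : ℕ} {S : Matrix (Fin k) (Fin k) ℝ} (hS : S.PosDef) (i : Fin k) :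
    0 < LDL.diagEntries hS i := by
  have h : (LDL.diag hS).PosDef := by
    rw [LDL.diag_eq_lowerInv_conj]
    exact hS.mul_mul_conjTranspose_same
      (Matrix.vecMul_injective_of_isUnit (isUnit_of_invertible (LDL.lowerInv hS)))
  simpa [LDL.diag] using h.diag_pos (i := i)

/-- **Cholesky factorization** of a real positive definite matrix. -/
theorem Matrix.PosDef.exists_cholesky {k : ℕ} {S : Matrix (Fin k) (Fin k) ℝ} (hS : S.PosDef) :
    ∃ L : Matrix (Fin k) (Fin k) ℝ, IsLowerTri L ∧ PosDiag L ∧ L * Lᵀ = S := by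
  set Q := LDL.lower hS with hQ
  set d := LDL.diagEntries hS
  have hd : ∀ i, 0 < d i := LDL.diagEntries_pos hS
  have hQt : IsLowerTri Q := LDL.lower_lowerTri hS
  have hQ0 : ∀ i, Q i i ≠ 0 := hQt.diag_ne_zero <| by
    have : IsUnit Q := by
      rw [hQ, LDL.lower, Matrix.isUnit_nonsing_inv_iff]
      exact isUnit_of_invertible _
    exact ((Matrix.isUnit_iff_isUnit_det _).mp this).ne_zero
  let s : Fin k → ℝ := fun i => √(d i) * (|Q i i| / Q i i)
  have hs : ∀ i, s i * s i = d i := fun i => by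
    have h1 : |Q i i| / Q i i * (|Q i i| / Q i i) = 1 := by
      rw [div_mul_div_comm, abs_mul_abs_self, div_self (mul_ne_zero (hQ0 i) (hQ0 i))]
    rw [mul_mul_mul_comm, h1, Real.mul_self_sqrt (hd i).le, mul_one]
  refine ⟨Q * Matrix.diagonal s, fun i j hij => ?_, fun i => ?_, ?_⟩
  · rw [Matrix.mul_diagonal, hQt i j hij, zero_mul]
  · have : Q i i * s i = √(d i) * |Q i i| := by
      simp only [s]
      field [hQ0 i]
    rw [Matrix.mul_diagonal, this]
    exact mul_pos (Real.sqrt_pos.mpr (hd i)) (abs_pos.mpr (hQ0 i))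
  · have hdiag : Matrix.diagonal s * Matrix.diagonal s = LDL.diag hS := by
      rw [Matrix.diagonal_mul_diagonal]
      exact congrArg Matrix.diagonal (funext hs)
    rw [Matrix.transpose_mul, Matrix.diagonal_transpose, Matrix.mul_assoc,
      ← Matrix.mul_assoc (Matrix.diagonal s), hdiag, ← Matrix.mul_assoc]
    simpa using LDL.lower_conj_diag hS

theorem Jmat_eq_reindex (m n : ℕ) :
    Jmat m n = Matrix.reindex finSumFinEquiv finSumFinEquiv
      (Matrix.fromBlocks (1 : Matrix (Fin m) (Fin m) ℝ) 0 0 (-1 : Matrix (Fin n) (Fin n) ℝ)) := by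
  rw [← Equiv.symm_apply_eq]
  ext (i | i) (j | j)
  · simp [Jmat, Matrix.diagonal_apply, Matrix.one_apply]
  · simp [Jmat, Matrix.diagonal_apply, Fin.ext_iff]
    lia
  · simp [Jmat, Matrix.diagonal_apply, Fin.ext_iff]
    lia
  · by_cases h : i = j <;> simp [Jmat, h]

theorem IsLowerTri.reindex_fromBlocks {m n : ℕ} {L₁ : Matrix (Fin m) (Fin m) ℝ}
    {L₂ : Matrix (Fin n) (Fin n) ℝ} (h₁ : IsLowerTri L₁) (h₂ : IsLowerTri L₂)
    (X : Matrix (Fin n) (Fin m) ℝ) :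
    IsLowerTri (Matrix.reindex finSumFinEquiv finSumFinEquiv (Matrix.fromBlocks L₁ 0 X L₂)) := by
  intro i j
  induction i using Fin.addCases <;> induction j using Fin.addCases <;> intro hij
  · simpa using h₁ _ _ hij
  · simp
  · simp [Fin.lt_def] at hij
    lia
  · simpa using h₂ _ _ (by simpa using hij)

theorem PosDiag.reindex_fromBlocks {m n : ℕ} {L₁ : Matrix (Fin m) (Fin m) ℝ}
    {L₂ : Matrix (Fin n) (Fin n) ℝ} (h₁ : PosDiag L₁) (h₂ : PosDiag L₂)
    (X : Matrix (Fin n) (Fin m) ℝ) :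
    PosDiag (Matrix.reindex finSumFinEquiv finSumFinEquiv (Matrix.fromBlocks L₁ 0 X L₂)) := by
  intro i
  induction i using Fin.addCases
  · simpa using h₁ _
  · simpa using h₂ _

theorem stmt5 (m n : ℕ) (A : Matrix (Fin m) (Fin m) ℝ) (B : Matrix (Fin n) (Fin m) ℝ)
    (C : Matrix (Fin n) (Fin n) ℝ) (hA : A.PosDef) (hB : B.rank = n) (hC : C.PosSemidef) :
    ∃ L : Matrix (Fin (m + n)) (Fin (m + n)) ℝ, IsLowerTri L ∧ PosDiag L ∧
      (Matrix.reindex finSumFinEquiv finSumFinEquiv (Matrix.fromBlocks A Bᵀ B (-C)))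
        = L * Jmat m n * Lᵀ := by
  obtain ⟨L₁, hL₁, hL₁pos, rfl⟩ := hA.exists_cholesky
  have hdet : IsUnit (L₁ᵀ).det := by
    rw [Matrix.det_transpose, Matrix.det_of_isLowerTriangular L₁ fun i j hij => hL₁ i j hij]
    exact (Finset.prod_pos fun i _ => hL₁pos i).ne'.isUnit
  set X := B * (L₁ᵀ)⁻¹ with hX
  have hXL : X * L₁ᵀ = B := Matrix.nonsing_inv_mul_cancel_right _ _ hdet
  have hXrank : X.rank = Fintype.card (Fin n) := by
    rw [hX, Matrix.rank_mul_eq_left_of_isUnit_det _ _ (Matrix.isUnit_nonsing_inv_det _ hdet), hB,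
      Fintype.card_fin]
  have hS : (C + X * Xᵀ).PosDef := by
    simpa using Matrix.PosDef.posSemidef_add hC
      (Matrix.PosDef.mul_conjTranspose_self X (Matrix.vecMul_injective_of_rank_eq hXrank))
  obtain ⟨L₂, hL₂, hL₂pos, hL₂eq⟩ := hS.exists_cholesky
  refine ⟨_, hL₁.reindex_fromBlocks hL₂ X, hL₁pos.reindex_fromBlocks hL₂pos X, ?_⟩
  have hLX : L₁ * Xᵀ = Bᵀ := by
    simpa using congrArg Matrix.transpose hXL
  rw [Jmat_eq_reindex, Matrix.transpose_reindex]
  simp only [Matrix.reindex_apply, Matrix.submatrix_mul_equiv, Matrix.fromBlocks_transpose,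
    Matrix.fromBlocks_multiply]
  congr 1
  simp [hXL, hLX, hL₂eq]
end

section
/- Let K be an (m+n)×(m+n) symmetric real matrix, and suppose L and L′ are both (m+n)×(m+n) lower triangular real matrices with positive diagonal entries satisfying K = L·J_{m+n}·Lᵀ = L′·J_{m+n}·L′ᵀ. Then L = L′. -/
open Matrix

/-- A factorization `L * D * Lᵀ` with `D` diagonal and invertible determines the lower triangular
factor `L` with positive diagonal. -/
theorem eq_of_mul_diagonal_mul_transpose_eq {k : ℕ} {d : Fin k → ℝ} (hd : ∀ i, d i ≠ 0)
    {L L' : Matrix (Fin k) (Fin k) ℝ} (hL : IsLowerTri L) (hLd : PosDiag L)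
    (hL' : IsLowerTri L') (hL'd : PosDiag L')
    (h : L * diagonal d * Lᵀ = L' * diagonal d * L'ᵀ) : L = L' := by
  suffices hcol : ∀ j i, L i j = L' i j from Matrix.ext fun i j => hcol j i
  intro j
  induction j using WellFoundedLT.induction with
  | ind j ih =>
    have key (i : Fin k) : L i j * L j j = L' i j * L' j j := by
      have hij := congrFun (congrFun h i) j
      simp only [mul_apply (M := L * diagonal d), mul_apply (M := L' * diagonal d),
        mul_diagonal, transpose_apply] at hij
      rw [← sub_eq_zero, ← Finset.sum_sub_distrib, Finset.sum_eq_single j] at hij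
      · apply mul_left_cancel₀ (hd j)
        linarith
      · intro l _ hlj
        rcases lt_or_gt_of_ne hlj with hlt | hgt
        · rw [ih l hlt i, ih l hlt j, sub_self]
        · rw [hL j l hgt, hL' j l hgt, mul_zero, mul_zero, sub_self]
      · simp
    have hjj : L j j = L' j j :=
      (mul_self_inj (hLd j).le (hL'd j).le).1 (key j)
    intro i
    have hi := key i
    rw [← hjj] at hi
    exact mul_right_cancel₀ (hLd j).ne' hi

theorem stmt6 (m n : ℕ) (K L L' : Matrix (Fin (m + n)) (Fin (m + n)) ℝ)
    (hK : Kᵀ = K)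
    (hL : IsLowerTri L) (hLd : PosDiag L)
    (hL' : IsLowerTri L') (hL'd : PosDiag L')
    (h1 : K = L * Jmat m n * Lᵀ) (h2 : K = L' * Jmat m n * L'ᵀ) :
    L = L' := by
  refine eq_of_mul_diagonal_mul_transpose_eq (fun i => ?_) hL hLd hL' hL'd (h1.symm.trans h2)
  split_ifs <;> norm_num
end

section
/- Let K be an (m+n)×(m+n) symmetric real matrix with generalized Cholesky factorization K = L·J_{m+n}·Lᵀ, where L is lower triangular with positive diagonal entries, and let ΔK be an (m+n)×(m+n) symmetric real matrix with ‖L⁻¹‖₂² · ‖ΔK‖_F < 1/2. If ΔL is a matrix such that L + ΔL is lower triangular with positive diagonal entries and K + ΔK = (L + ΔL)·J_{m+n}·(L + ΔL)ᵀ, then for every (m+n)×(m+n) diagonal matrix D with positive diagonal entries, ‖ΔL‖_F ≤ √2 · ‖L⁻¹‖₂ · κ₂(L·D⁻¹) · ‖ΔK‖_F / (√2 − 1 + √(1 − 2·‖L⁻¹‖₂²·‖ΔK‖_F)). -/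
open Matrix

attribute [local instance] Matrix.frobeniusNormedRing Matrix.frobeniusNormedSpace

theorem norm_eq_frobNorm {k : ℕ} (A : Matrix (Fin k) (Fin k) ℝ) : ‖A‖ = frobNorm A := by
  rw [Matrix.frobenius_norm_def, frobNorm, Real.sqrt_eq_rpow]
  simp

theorem norm_sq_eq_sum {k : ℕ} (A : Matrix (Fin k) (Fin k) ℝ) :
    ‖A‖ ^ 2 = ∑ i, ∑ j, A i j ^ 2 := by
  rw [norm_eq_frobNorm, frobNorm, Real.sq_sqrt (by positivity)]

theorem norm_transpose_eq {k : ℕ} (A : Matrix (Fin k) (Fin k) ℝ) : ‖Aᵀ‖ = ‖A‖ := by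
  rw [norm_eq_frobNorm, norm_eq_frobNorm, frobNorm, frobNorm, Finset.sum_comm]
  rfl

theorem norm_le_of_sq_entries_le {k : ℕ} {A B : Matrix (Fin k) (Fin k) ℝ}
    (h : ∀ i j, A i j ^ 2 ≤ B i j ^ 2) : ‖A‖ ≤ ‖B‖ := by
  rw [← sq_le_sq₀ (norm_nonneg _) (norm_nonneg _), norm_sq_eq_sum, norm_sq_eq_sum]
  exact Finset.sum_le_sum fun i _ => Finset.sum_le_sum fun j _ => h i j

theorem specNorm_nonneg {k : ℕ} (A : Matrix (Fin k) (Fin k) ℝ) : 0 ≤ specNorm A :=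
  norm_nonneg _

theorem norm_mul_le_specNorm_mul {k : ℕ} (A B : Matrix (Fin k) (Fin k) ℝ) :
    ‖A * B‖ ≤ specNorm A * ‖B‖ := by
  rw [← sq_le_sq₀ (norm_nonneg _) (mul_nonneg (specNorm_nonneg A) (norm_nonneg _)), mul_pow,
    norm_sq_eq_sum, norm_sq_eq_sum, Finset.sum_comm, Finset.sum_comm (f := fun i j => B i j ^ 2),
    Finset.mul_sum]
  refine Finset.sum_le_sum fun j _ => ?_
  have h := (Matrix.toEuclideanCLM (𝕜 := ℝ) A).le_opNorm (WithLp.toLp 2 fun i => B i j)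
  rw [← sq_le_sq₀ (norm_nonneg _) (by positivity), mul_pow, EuclideanSpace.norm_sq_eq,
    EuclideanSpace.norm_sq_eq] at h
  simpa [specNorm, Matrix.mul_apply, Matrix.mulVec, dotProduct] using h

theorem norm_mul_diagonal_sign {k : ℕ} {s : Fin k → ℝ} (hs : ∀ i, s i * s i = 1)
    (A : Matrix (Fin k) (Fin k) ℝ) : ‖A * diagonal s‖ = ‖A‖ := by
  have h : ∀ i j, (A * diagonal s) i j ^ 2 = A i j ^ 2 := fun i j => by
    rw [mul_diagonal, mul_pow, pow_two (s j), hs, mul_one]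
  exact le_antisymm (norm_le_of_sq_entries_le fun i j => (h i j).le)
    (norm_le_of_sq_entries_le fun i j => (h i j).ge)

/-- The lower triangular part of a matrix, with halved diagonal. -/
noncomputable def lowTri {k : ℕ} (A : Matrix (Fin k) (Fin k) ℝ) : Matrix (Fin k) (Fin k) ℝ :=
  Matrix.of fun i j => if j < i then A i j else if i = j then A i j / 2 else 0

theorem lowTri_apply {k : ℕ} (A : Matrix (Fin k) (Fin k) ℝ) (i j : Fin k) :
    lowTri A i j = if j < i then A i j else if i = j then A i j / 2 else 0 := rfl

theorem isLowerTri_lowTri {k : ℕ} (A : Matrix (Fin k) (Fin k) ℝ) : IsLowerTri (lowTri A) := by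
  intro i j h
  rw [lowTri_apply, if_neg h.not_gt, if_neg h.ne]

theorem lowTri_sub {k : ℕ} (A B : Matrix (Fin k) (Fin k) ℝ) :
    lowTri (A - B) = lowTri A - lowTri B := by
  ext i j
  simp only [lowTri_apply, Matrix.sub_apply]
  split_ifs <;> ring

theorem diagonal_mul_lowTri {k : ℕ} (d : Fin k → ℝ) (A : Matrix (Fin k) (Fin k) ℝ) :
    diagonal d * lowTri A = lowTri (diagonal d * A) := by
  ext i j
  simp only [lowTri_apply, diagonal_mul]
  split_ifs <;> ring

theorem lowTri_add_transpose {k : ℕ} {A : Matrix (Fin k) (Fin k) ℝ} (hA : Aᵀ = A) :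
    lowTri A + (lowTri A)ᵀ = A := by
  ext i j
  have h : A j i = A i j := congrFun (congrFun hA i) j
  rw [Matrix.add_apply, transpose_apply, lowTri_apply, lowTri_apply, h]
  rcases lt_trichotomy i j with hij | rfl | hij
  · simp [hij, hij.not_gt, hij.ne]
  · simp
  · simp [hij, hij.not_gt, hij.ne]

theorem norm_lowTri_le {k : ℕ} (A : Matrix (Fin k) (Fin k) ℝ) : ‖lowTri A‖ ≤ ‖A‖ := by
  refine norm_le_of_sq_entries_le fun i j => ?_
  rw [lowTri_apply]
  split_ifs <;> nlinarith [sq_nonneg (A i j)]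

theorem sqrt_two_mul_norm_lowTri_le {k : ℕ} {A : Matrix (Fin k) (Fin k) ℝ} (hA : Aᵀ = A) :
    √2 * ‖lowTri A‖ ≤ ‖A‖ := by
  rw [← sq_le_sq₀ (by positivity) (norm_nonneg _), mul_pow, Real.sq_sqrt zero_le_two, two_mul]
  nth_rewrite 2 [← norm_transpose_eq]
  simp only [norm_sq_eq_sum, ← Finset.sum_add_distrib]
  refine Finset.sum_le_sum fun i _ => Finset.sum_le_sum fun j _ => ?_
  have h : A j i = A i j := congrFun (congrFun hA i) j
  rw [transpose_apply, lowTri_apply, lowTri_apply, h]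
  rcases lt_trichotomy i j with hij | rfl | hij
  · simp [hij, hij.not_gt, hij.ne]
  · simp only [lt_self_iff_false, if_true, if_false]
    nlinarith [sq_nonneg (A i i)]
  · simp [hij, hij.not_gt, hij.ne]

theorem IsLowerTri.blockTriangular {k : ℕ} {A : Matrix (Fin k) (Fin k) ℝ} (hA : IsLowerTri A) :
    A.BlockTriangular OrderDual.toDual := fun i j h => hA i j h

theorem IsLowerTri.mul {k : ℕ} {A B : Matrix (Fin k) (Fin k) ℝ} (hA : IsLowerTri A)
    (hB : IsLowerTri B) : IsLowerTri (A * B) := fun _ _ h =>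
  (hA.blockTriangular.mul hB.blockTriangular) h

theorem IsLowerTri.mul_apply_self {k : ℕ} {A B : Matrix (Fin k) (Fin k) ℝ} (hA : IsLowerTri A)
    (hB : IsLowerTri B) (i : Fin k) : (A * B) i i = A i i * B i i := by
  rw [Matrix.mul_apply]
  refine Finset.sum_eq_single i (fun j _ hj => ?_) (by simp)
  rcases hj.lt_or_gt with h | h
  · rw [hB j i h, mul_zero]
  · rw [hA i j h, zero_mul]

theorem IsLowerTri.isUnit_det {k : ℕ} {A : Matrix (Fin k) (Fin k) ℝ} (hA : IsLowerTri A)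
    (hd : PosDiag A) : IsUnit A.det := by
  rw [Matrix.det_of_isLowerTriangular A hA.blockTriangular]
  exact (Finset.prod_pos fun i _ => hd i).ne'.isUnit

theorem IsLowerTri.inv {k : ℕ} {A : Matrix (Fin k) (Fin k) ℝ} (hA : IsLowerTri A)
    (h : IsUnit A.det) : IsLowerTri A⁻¹ := by
  have := A.invertibleOfIsUnitDet h
  exact fun _ _ hij => Matrix.blockTriangular_inv_of_blockTriangular hA.blockTriangular hij

/-- Uniqueness of the generalized Cholesky factorization. -/
theorem generalizedCholesky_unique {k : ℕ} {s : Fin k → ℝ} (hs : ∀ i, s i * s i = 1)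
    {A B : Matrix (Fin k) (Fin k) ℝ} (hA : IsLowerTri A) (hAd : PosDiag A)
    (hB : IsLowerTri B) (hBd : PosDiag B)
    (h : A * diagonal s * Aᵀ = B * diagonal s * Bᵀ) : A = B := by
  have hAu := hA.isUnit_det hAd
  have hBu := hB.isUnit_det hBd
  set P := B⁻¹ * A with hP
  have hPl : IsLowerTri P := (hB.inv hBu).mul hA
  have hBP : B * P = A := mul_nonsing_inv_cancel_left _ _ hBu
  have hPu : IsUnit P.det := by
    rw [hP, det_mul]
    exact (isUnit_nonsing_inv_det _ hBu).mul hAu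
  have hPs : P * diagonal s * Pᵀ = diagonal s := by
    calc P * diagonal s * Pᵀ = B⁻¹ * (A * diagonal s * Aᵀ) * (B⁻¹)ᵀ := by
          rw [hP, transpose_mul]; simp only [Matrix.mul_assoc]
      _ = (B⁻¹ * B) * diagonal s * (B⁻¹ * B)ᵀ := by
          rw [h, transpose_mul]; simp only [Matrix.mul_assoc]
      _ = diagonal s := by rw [nonsing_inv_mul _ hBu]; simp
  have hPi : P * diagonal s = diagonal s * (P⁻¹)ᵀ := by
    calc P * diagonal s = P * diagonal s * (P⁻¹ * P)ᵀ := by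
          rw [nonsing_inv_mul _ hPu]; simp
      _ = (P * diagonal s * Pᵀ) * (P⁻¹)ᵀ := by
          rw [transpose_mul]; simp only [Matrix.mul_assoc]
      _ = _ := by rw [hPs]
  have hoff : ∀ i j, i ≠ j → P i j = 0 := by
    intro i j hij
    rcases hij.lt_or_gt with hlt | hlt
    · exact hPl i j hlt
    · have h1 := congrFun (congrFun hPi i) j
      rw [mul_diagonal, diagonal_mul, transpose_apply, hPl.inv hPu j i hlt, mul_zero] at h1
      exact (mul_eq_zero.mp h1).resolve_right (left_ne_zero_of_mul_eq_one (hs j))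
  have hdiag : ∀ i, P i i = 1 := by
    intro i
    have hpos : 0 < P i i := by
      have h1 := hB.mul_apply_self hPl i
      rw [hBP] at h1
      exact pos_of_mul_pos_right (h1 ▸ hAd i) (hBd i).le
    have h2 := congrFun (congrFun hPs i) i
    rw [Matrix.mul_apply, Finset.sum_eq_single i
      (fun j _ hj => by rw [transpose_apply, hoff i j hj.symm, mul_zero]) (by simp),
      mul_diagonal, transpose_apply, diagonal_apply_eq] at h2
    have h3 : P i i * P i i = 1 := by
      linear_combination s i * h2 + (1 - P i i * P i i) * hs i
    nlinarith
  have hP1 : P = 1 := by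
    ext i j
    by_cases hij : i = j
    · subst hij; rw [hdiag, one_apply_eq]
    · rw [hoff i j hij, one_apply_ne hij]
  rw [← hBP, hP1, mul_one]

theorem norm_mul_sign_mul_transpose_le {k : ℕ} {s : Fin k → ℝ} (hs : ∀ i, s i * s i = 1)
    (A B : Matrix (Fin k) (Fin k) ℝ) : ‖A * diagonal s * Bᵀ‖ ≤ ‖A‖ * ‖B‖ := by
  refine (norm_mul_le _ _).trans_eq ?_
  rw [norm_mul_diagonal_sign hs, norm_transpose_eq]

theorem transpose_mul_diagonal_mul_transpose {k : ℕ} (s : Fin k → ℝ)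
    (A : Matrix (Fin k) (Fin k) ℝ) : (A * diagonal s * Aᵀ)ᵀ = A * diagonal s * Aᵀ := by
  simp [transpose_mul, Matrix.mul_assoc]

/-- A small symmetric perturbation of a signature matrix has a generalized Cholesky factor close
to the identity, obtained as a fixed point of a contraction. -/
theorem exists_eq_lowTri_sub {k : ℕ} {s : Fin k → ℝ} (hs : ∀ i, s i * s i = 1)
    {M : Matrix (Fin k) (Fin k) ℝ} (hM : Mᵀ = M) {e : ℝ} (hMe : ‖M‖ ≤ e) (he : e < 1 / 2) :
    ∃ Y, Y = lowTri (M - Y * diagonal s * Yᵀ) ∧ √2 * ‖Y‖ ≤ 1 - √(1 - 2 * e) := by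
  have he0 : 0 ≤ e := (norm_nonneg M).trans hMe
  set q := 1 - √(1 - 2 * e)
  have hsq : √(1 - 2 * e) ^ 2 = 1 - 2 * e := Real.sq_sqrt (by linarith)
  have hpos : 0 < √(1 - 2 * e) := Real.sqrt_pos.mpr (by linarith)
  have hq1 : q < 1 := by linarith
  have hq0 : 0 ≤ q := by
    have : √(1 - 2 * e) ≤ 1 := Real.sqrt_le_one.mpr (by linarith)
    linarith
  have h2 : √2 ^ 2 = 2 := Real.sq_sqrt zero_le_two
  let f : Matrix (Fin k) (Fin k) ℝ → Matrix (Fin k) (Fin k) ℝ :=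
    fun Y => lowTri (M - Y * diagonal s * Yᵀ)
  let S : Set (Matrix (Fin k) (Fin k) ℝ) := {Y | √2 * ‖Y‖ ≤ q}
  have hSc : IsClosed S := isClosed_le (by fun_prop) continuous_const
  have : CompleteSpace (Matrix (Fin k) (Fin k) ℝ) := FiniteDimensional.complete ℝ _
  have hmaps : Set.MapsTo f S S := by
    intro Y hY
    have hY' : √2 * ‖Y‖ ≤ q := hY
    have h1 : √2 * ‖f Y‖ ≤ ‖M - Y * diagonal s * Yᵀ‖ := sqrt_two_mul_norm_lowTri_le (by
      rw [transpose_sub, hM, transpose_mul_diagonal_mul_transpose])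
    have h3 := norm_sub_le M (Y * diagonal s * Yᵀ)
    have h4 := norm_mul_sign_mul_transpose_le hs Y Y
    have h5 : (√2 * ‖Y‖) ^ 2 ≤ q ^ 2 := pow_le_pow_left₀ (by positivity) hY' 2
    change √2 * ‖f Y‖ ≤ q
    rw [mul_pow, h2] at h5
    nlinarith
  have hlip : ∀ Y ∈ S, ∀ Z ∈ S, ‖f Y - f Z‖ ≤ q * ‖Y - Z‖ := by
    intro Y hY Z hZ
    have hY' : √2 * ‖Y‖ ≤ q := hY
    have hZ' : √2 * ‖Z‖ ≤ q := hZ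
    have hsub : f Y - f Z = lowTri (Z * diagonal s * Zᵀ - Y * diagonal s * Yᵀ) := by
      rw [← lowTri_sub]
      congr 1
      abel
    have h1 : √2 * ‖f Y - f Z‖ ≤ ‖Z * diagonal s * Zᵀ - Y * diagonal s * Yᵀ‖ := by
      rw [hsub]
      exact sqrt_two_mul_norm_lowTri_le (by
        rw [transpose_sub, transpose_mul_diagonal_mul_transpose,
          transpose_mul_diagonal_mul_transpose])
    have h3 : Y * diagonal s * Yᵀ - Z * diagonal s * Zᵀ =
        (Y - Z) * diagonal s * Yᵀ + Z * diagonal s * (Y - Z)ᵀ := by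
      rw [transpose_sub]
      noncomm_ring
    rw [norm_sub_rev (Z * diagonal s * Zᵀ), h3] at h1
    have h4 := norm_add_le ((Y - Z) * diagonal s * Yᵀ) (Z * diagonal s * (Y - Z)ᵀ)
    have h5 := norm_mul_sign_mul_transpose_le hs (Y - Z) Y
    have h6 := norm_mul_sign_mul_transpose_le hs Z (Y - Z)
    have h7 : √2 * ‖f Y - f Z‖ ≤ ‖Y - Z‖ * (‖Y‖ + ‖Z‖) := by linarith
    have h8 : ‖Y - Z‖ * (√2 * ‖Y‖ + √2 * ‖Z‖) ≤ ‖Y - Z‖ * (q + q) := by gcongr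
    have h9 : √2 * (√2 * ‖f Y - f Z‖) ≤ √2 * (‖Y - Z‖ * (‖Y‖ + ‖Z‖)) := by gcongr
    rw [← mul_assoc, ← pow_two, h2] at h9
    linarith
  have hcontr : ContractingWith ⟨q, hq0⟩ (hmaps.restrict f S S) := by
    refine ⟨hq1, LipschitzWith.of_dist_le_mul fun Y Z => ?_⟩
    rw [Subtype.dist_eq, Subtype.dist_eq, dist_eq_norm, dist_eq_norm]
    exact hlip Y Y.2 Z Z.2
  have h0 : (0 : Matrix (Fin k) (Fin k) ℝ) ∈ S := by
    change √2 * ‖(0 : Matrix (Fin k) (Fin k) ℝ)‖ ≤ q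
    simpa using hq0
  obtain ⟨Y, hYS, hYf, -⟩ :=
    hcontr.exists_fixedPoint' hSc.isComplete hmaps h0 (edist_ne_top _ _)
  exact ⟨Y, hYf.symm, hYS⟩

theorem abs_apply_le_norm {k : ℕ} (A : Matrix (Fin k) (Fin k) ℝ) (i j : Fin k) :
    |A i j| ≤ ‖A‖ := by
  refine abs_le_of_sq_le_sq ?_ (norm_nonneg _)
  rw [norm_sq_eq_sum]
  exact (Finset.single_le_sum (f := fun j => A i j ^ 2) (fun _ _ => sq_nonneg _)
    (Finset.mem_univ j)).trans (Finset.single_le_sum (f := fun i => ∑ j, A i j ^ 2)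
      (fun _ _ => Finset.sum_nonneg fun _ _ => sq_nonneg _) (Finset.mem_univ i))

/-- Perturbation of the identity factor: every generalized Cholesky factor of a small symmetric
perturbation of a signature matrix is given by the fixed point of `exists_eq_lowTri_sub`. -/
theorem exists_factor_eq_one_add {k : ℕ} {s : Fin k → ℝ} (hs : ∀ i, s i * s i = 1)
    {M A : Matrix (Fin k) (Fin k) ℝ} (hM : Mᵀ = M) {e : ℝ} (hMe : ‖M‖ ≤ e) (he : e < 1 / 2)
    (hA : IsLowerTri A) (hAd : PosDiag A) (h : A * diagonal s * Aᵀ = diagonal s + M) :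
    ∃ Y, Y = lowTri (M - Y * diagonal s * Yᵀ) ∧ √2 * ‖Y‖ ≤ 1 - √(1 - 2 * e) ∧
      A = 1 + Y * diagonal s := by
  obtain ⟨Y, hY, hYn⟩ := exists_eq_lowTri_sub hs hM hMe he
  refine ⟨Y, hY, hYn, ?_⟩
  have hYl : IsLowerTri Y := by rw [hY]; exact isLowerTri_lowTri _
  have hss : diagonal s * diagonal s = 1 := by
    rw [diagonal_mul_diagonal]
    simp [hs]
  have hY1 : ‖Y‖ < 1 := by
    have hpos : 0 < √(1 - 2 * e) := Real.sqrt_pos.mpr (by linarith)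
    have : 1 ≤ √2 := Real.one_le_sqrt.mpr one_le_two
    nlinarith [norm_nonneg Y]
  refine generalizedCholesky_unique hs hA hAd (fun i j hij => ?_) (fun i => ?_) ?_
  · rw [Matrix.add_apply, one_apply_ne hij.ne, mul_diagonal, hYl i j hij, zero_mul, add_zero]
  · rw [Matrix.add_apply, one_apply_eq, mul_diagonal]
    have h1 : |Y i i * s i| < 1 := by
      have habs : |s i| = 1 := by
        rcases mul_self_eq_one_iff.mp (hs i) with h1 | h1 <;> simp [h1]
      rw [abs_mul, habs, mul_one]
      exact (abs_apply_le_norm Y i i).trans_lt hY1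
    linarith [(abs_lt.mp h1).1]
  · have hsum : Y + Yᵀ = M - Y * diagonal s * Yᵀ := by
      have := lowTri_add_transpose (A := M - Y * diagonal s * Yᵀ) (by
        rw [transpose_sub, hM, transpose_mul_diagonal_mul_transpose])
      rwa [← hY] at this
    rw [h, transpose_add, transpose_one, transpose_mul, diagonal_transpose]
    calc diagonal s + M = diagonal s + (Y + Yᵀ) + Y * diagonal s * Yᵀ := by rw [hsum]; abel
      _ = diagonal s + Y * (diagonal s * diagonal s) + (diagonal s * diagonal s) * Yᵀ
          + Y * (diagonal s * diagonal s) * diagonal s * Yᵀ := by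
        rw [hss]; noncomm_ring
      _ = _ := by noncomm_ring

theorem stmt8 (m n : ℕ) (K L dK dL D : Matrix (Fin (m + n)) (Fin (m + n)) ℝ)
    (hK : Kᵀ = K) (hL : IsLowerTri L) (hLd : PosDiag L)
    (hfact : K = L * Jmat m n * Lᵀ)
    (hdK : dKᵀ = dK)
    (hsmall : specNorm L⁻¹ ^ 2 * frobNorm dK < 1 / 2)
    (hL' : IsLowerTri (L + dL)) (hL'd : PosDiag (L + dL))
    (hfact' : K + dK = (L + dL) * Jmat m n * (L + dL)ᵀ)
    (hD : D.IsDiag) (hDpos : ∀ i, 0 < D i i) :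
    frobNorm dL ≤ Real.sqrt 2 * specNorm L⁻¹ * kappa2 (L * D⁻¹) * frobNorm dK /
      (Real.sqrt 2 - 1 + Real.sqrt (1 - 2 * specNorm L⁻¹ ^ 2 * frobNorm dK)) := by
  set s : Fin (m + n) → ℝ := fun i => if (i : ℕ) < m then 1 else -1 with hsdef
  have hJ : Jmat m n = diagonal s := rfl
  have hs : ∀ i, s i * s i = 1 := fun i => by
    simp only [hsdef]
    split_ifs <;> norm_num
  rw [hJ] at hfact hfact'
  simp only [← norm_eq_frobNorm] at hsmall ⊢
  have hLu := hL.isUnit_det hLd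
  have hLi := hL.inv hLu
  obtain ⟨d, rfl⟩ : ∃ d, D = diagonal d := ⟨D.diag, hD.diagonal_diag.symm⟩
  have hd : ∀ i, d i ≠ 0 := fun i => by simpa using (hDpos i).ne'
  have hDu : IsUnit (diagonal d).det := by
    rw [det_diagonal]
    exact (Finset.prod_ne_zero_iff.mpr fun i _ => hd i).isUnit
  set M := L⁻¹ * (dK * (L⁻¹)ᵀ) with hMdef
  have hM : Mᵀ = M := by
    simp only [hMdef, transpose_mul, transpose_transpose, hdK, Matrix.mul_assoc]
  have hdKL : ‖dK * (L⁻¹)ᵀ‖ ≤ specNorm L⁻¹ * ‖dK‖ := by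
    rw [← norm_transpose_eq, transpose_mul, transpose_transpose, hdK]
    exact norm_mul_le_specNorm_mul _ _
  have hMe : ‖M‖ ≤ specNorm L⁻¹ ^ 2 * ‖dK‖ := by
    calc ‖M‖ ≤ specNorm L⁻¹ * ‖dK * (L⁻¹)ᵀ‖ := norm_mul_le_specNorm_mul _ _
      _ ≤ specNorm L⁻¹ * (specNorm L⁻¹ * ‖dK‖) :=
        mul_le_mul_of_nonneg_left hdKL (specNorm_nonneg _)
      _ = _ := by ring
  have hAl : IsLowerTri (L⁻¹ * (L + dL)) := hLi.mul hL'
  have hAd : PosDiag (L⁻¹ * (L + dL)) := by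
    intro i
    have h1 := hL.mul_apply_self hAl i
    rw [mul_nonsing_inv_cancel_left _ _ hLu] at h1
    exact pos_of_mul_pos_right (h1 ▸ hL'd i) (hLd i).le
  have hAf : L⁻¹ * (L + dL) * diagonal s * (L⁻¹ * (L + dL))ᵀ = diagonal s + M := by
    calc L⁻¹ * (L + dL) * diagonal s * (L⁻¹ * (L + dL))ᵀ
        = L⁻¹ * ((L + dL) * diagonal s * (L + dL)ᵀ) * (L⁻¹)ᵀ := by
          rw [transpose_mul]; simp only [Matrix.mul_assoc]
      _ = (L⁻¹ * L) * diagonal s * (L⁻¹ * L)ᵀ + M := by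
          rw [← hfact', hfact, transpose_mul, hMdef]
          simp only [Matrix.mul_assoc, Matrix.mul_add, Matrix.add_mul]
      _ = diagonal s + M := by rw [nonsing_inv_mul _ hLu]; simp
  obtain ⟨Y, hY, hYn, hAY⟩ := exists_factor_eq_one_add hs hM hMe hsmall hAl hAd hAf
  have hdL : dL = L * Y * diagonal s := by
    have h1 : L * (L⁻¹ * (L + dL)) = L * (1 + Y * diagonal s) := by rw [hAY]
    rw [mul_nonsing_inv_cancel_left _ _ hLu, mul_add, mul_one, add_right_inj] at h1
    rw [h1, Matrix.mul_assoc]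
  have hdLn : ‖dL‖ ≤ specNorm (L * (diagonal d)⁻¹) * ‖diagonal d * Y‖ := by
    rw [hdL, norm_mul_diagonal_sign hs]
    refine le_trans (le_of_eq ?_) (norm_mul_le_specNorm_mul _ _)
    rw [Matrix.mul_assoc, nonsing_inv_mul_cancel_left _ _ hDu]
  have hinv : (L * (diagonal d)⁻¹)⁻¹ = diagonal d * L⁻¹ := by
    rw [Matrix.mul_inv_rev, nonsing_inv_nonsing_inv _ hDu]
  have hDM : ‖diagonal d * M‖ ≤
      specNorm (L * (diagonal d)⁻¹)⁻¹ * (specNorm L⁻¹ * ‖dK‖) := by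
    rw [hinv, hMdef, ← Matrix.mul_assoc]
    exact (norm_mul_le_specNorm_mul _ _).trans
      (mul_le_mul_of_nonneg_left hdKL (specNorm_nonneg _))
  have hDY : ‖diagonal d * Y‖ ≤ ‖diagonal d * M‖ + ‖diagonal d * Y‖ * ‖Y‖ := by
    have h1 : diagonal d * Y =
        lowTri (diagonal d * M - diagonal d * Y * diagonal s * Yᵀ) := by
      nth_rewrite 1 [hY]
      rw [diagonal_mul_lowTri, Matrix.mul_sub]
      simp only [Matrix.mul_assoc]
    calc ‖diagonal d * Y‖ ≤ ‖diagonal d * M - diagonal d * Y * diagonal s * Yᵀ‖ := by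
          nth_rewrite 1 [h1]
          exact norm_lowTri_le _
      _ ≤ ‖diagonal d * M‖ + ‖diagonal d * Y * diagonal s * Yᵀ‖ := norm_sub_le _ _
      _ ≤ _ := by
          gcongr
          exact norm_mul_sign_mul_transpose_le hs _ _
  have hnum : 2 * specNorm L⁻¹ ^ 2 * ‖dK‖ = 2 * (specNorm L⁻¹ ^ 2 * ‖dK‖) := by ring
  rw [hnum]
  set t := √(1 - 2 * (specNorm L⁻¹ ^ 2 * ‖dK‖))
  have ht : 0 ≤ t := Real.sqrt_nonneg _
  have h2 : 1 < √2 := Real.lt_sqrt_of_sq_lt (by norm_num)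
  rw [le_div_iff₀ (by linarith), kappa2]
  have hbound : ‖diagonal d * Y‖ * (√2 - 1 + t) ≤
      √2 * (specNorm (L * (diagonal d)⁻¹)⁻¹ * (specNorm L⁻¹ * ‖dK‖)) := by
    have h3 : ‖diagonal d * Y‖ * (√2 * ‖Y‖) ≤ ‖diagonal d * Y‖ * (1 - t) :=
      mul_le_mul_of_nonneg_left hYn (norm_nonneg _)
    have h4 := mul_le_mul_of_nonneg_left (hDY.trans <| add_le_add_left hDM _)
      (Real.sqrt_nonneg 2)
    linarith
  calc ‖dL‖ * (√2 - 1 + t)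
      ≤ specNorm (L * (diagonal d)⁻¹) * ‖diagonal d * Y‖ * (√2 - 1 + t) :=
        mul_le_mul_of_nonneg_right hdLn (by linarith)
    _ = specNorm (L * (diagonal d)⁻¹) * (‖diagonal d * Y‖ * (√2 - 1 + t)) := by ring
    _ ≤ _ := mul_le_mul_of_nonneg_left hbound (specNorm_nonneg _)
    _ = _ := by ring
end

section
/- Let L̃ be an invertible (m+n)×(m+n) real matrix, let ε ≥ 0, and let ΔK be an (m+n)×(m+n) real matrix with |ΔK| ≤ ε·|L̃|·|L̃ᵀ| entrywise. Then ‖L̃⁻¹·ΔK·L̃⁻ᵀ‖_F ≤ cond_F(L̃) · cond_F(L̃⁻ᵀ) · ε. -/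
open Matrix

theorem entAbs_nonneg {k : ℕ} (A : Matrix (Fin k) (Fin k) ℝ) (i j : Fin k) :
    0 ≤ entAbs A i j :=
  abs_nonneg _

theorem entAbs_mul_le {k : ℕ} (A B : Matrix (Fin k) (Fin k) ℝ) (i j : Fin k) :
    entAbs (A * B) i j ≤ (entAbs A * entAbs B) i j := by
  simp only [entAbs, Matrix.of_apply, Matrix.mul_apply, ← abs_mul]
  exact Finset.abs_sum_le_sum_abs _ _

theorem mul_entrywise_le_mul_left {k : ℕ} {A B C : Matrix (Fin k) (Fin k) ℝ}
    (hA : ∀ i j, 0 ≤ A i j) (h : ∀ i j, B i j ≤ C i j) (i j : Fin k) :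
    (A * B) i j ≤ (A * C) i j := by
  simp only [Matrix.mul_apply]
  exact Finset.sum_le_sum fun l _ => mul_le_mul_of_nonneg_left (h l j) (hA i l)

theorem mul_entrywise_le_mul_right {k : ℕ} {A B C : Matrix (Fin k) (Fin k) ℝ}
    (hA : ∀ i j, 0 ≤ A i j) (h : ∀ i j, B i j ≤ C i j) (i j : Fin k) :
    (B * A) i j ≤ (C * A) i j := by
  simp only [Matrix.mul_apply]
  exact Finset.sum_le_sum fun l _ => mul_le_mul_of_nonneg_right (h i l) (hA l j)

theorem frobNorm_mono {k : ℕ} {A B : Matrix (Fin k) (Fin k) ℝ}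
    (h : ∀ i j, |A i j| ≤ B i j) : frobNorm A ≤ frobNorm B :=
  Real.sqrt_le_sqrt <| Finset.sum_le_sum fun i _ => Finset.sum_le_sum fun j _ =>
    sq_le_sq.mpr ((h i j).trans (le_abs_self _))

theorem frobNorm_smul {k : ℕ} {c : ℝ} (hc : 0 ≤ c) (A : Matrix (Fin k) (Fin k) ℝ) :
    frobNorm (c • A) = c * frobNorm A := by
  simp only [frobNorm, Matrix.smul_apply, smul_eq_mul, mul_pow, ← Finset.mul_sum]
  rw [Real.sqrt_mul (sq_nonneg c), Real.sqrt_sq hc]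

section

attribute [local instance] Matrix.frobeniusNormedAddCommGroup

theorem frobNorm_eq_norm {k : ℕ} (A : Matrix (Fin k) (Fin k) ℝ) : frobNorm A = ‖A‖ := by
  simp [frobNorm, Matrix.frobenius_norm_def, Real.sqrt_eq_rpow]

theorem frobNorm_mul_le {k : ℕ} (A B : Matrix (Fin k) (Fin k) ℝ) :
    frobNorm (A * B) ≤ frobNorm A * frobNorm B := by
  simpa only [frobNorm_eq_norm] using Matrix.frobenius_norm_mul A B

end

theorem stmt14 (m n : ℕ) (L dK : Matrix (Fin (m + n)) (Fin (m + n)) ℝ) (ε : ℝ)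
    (hL : IsUnit L.det) (hε : 0 ≤ ε)
    (hdK : ∀ i j, |dK i j| ≤ ε * (entAbs L * entAbs Lᵀ) i j) :
    frobNorm (L⁻¹ * dK * L⁻¹ᵀ) ≤ condF L * condF (L⁻¹ᵀ) * ε := by
  have hinv : (L⁻¹ᵀ)⁻¹ = Lᵀ := by
    rw [← Matrix.transpose_nonsing_inv, Matrix.nonsing_inv_nonsing_inv L hL]
  have key : ∀ i j, |(L⁻¹ * dK * L⁻¹ᵀ) i j| ≤
      (ε • ((entAbs L⁻¹ * entAbs L) * (entAbs Lᵀ * entAbs L⁻¹ᵀ))) i j := by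
    intro i j
    calc |(L⁻¹ * dK * L⁻¹ᵀ) i j|
        ≤ (entAbs (L⁻¹ * dK) * entAbs L⁻¹ᵀ) i j := entAbs_mul_le _ _ i j
      _ ≤ (entAbs L⁻¹ * entAbs dK * entAbs L⁻¹ᵀ) i j :=
          mul_entrywise_le_mul_right (entAbs_nonneg _) (entAbs_mul_le _ _) i j
      _ ≤ (entAbs L⁻¹ * (ε • (entAbs L * entAbs Lᵀ)) * entAbs L⁻¹ᵀ) i j :=
          mul_entrywise_le_mul_right (entAbs_nonneg _)
            (mul_entrywise_le_mul_left (entAbs_nonneg _) hdK) i j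
      _ = _ := by simp only [Matrix.mul_smul, Matrix.smul_mul, Matrix.mul_assoc]
  calc frobNorm (L⁻¹ * dK * L⁻¹ᵀ)
      ≤ ε * frobNorm ((entAbs L⁻¹ * entAbs L) * (entAbs Lᵀ * entAbs L⁻¹ᵀ)) :=
        (frobNorm_mono key).trans_eq (frobNorm_smul hε _)
    _ ≤ ε * (frobNorm (entAbs L⁻¹ * entAbs L) * frobNorm (entAbs Lᵀ * entAbs L⁻¹ᵀ)) :=
        mul_le_mul_of_nonneg_left (frobNorm_mul_le _ _) hε
    _ = condF L * condF (L⁻¹ᵀ) * ε := by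
        rw [condF, condF, hinv, mul_comm]
end
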